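/- Necessity of linking to parents: assume I and Ī are nonempty, fix E_in(I) ≠ ∅ and E_Ī such that every node of Ī has at least one outlink in E_in(I) ∪ E_Ī, and let (H, F) be an optimal pair. Then F = {(i,j)} for a single pair with i ∈ I and j ∈ Ī, where j is a parent of I, i.e. (j,k) ∈ E_in(I) for some k ∈ I. -/

import Mathlib

open Matrix Finset

/-- Outdegree of node `i` in the edge set `E`. -/
def outdeg {n : ℕ} (E : Finset (Fin n × Fin n)) (i : Fin n) : ℕ :=
  (Finset.univ.filter (fun j => (i, j) ∈ E)).card

/-- The scaled adjacency matrix `P` of the graph: `P i j = 1 / outdeg i` if `(i,j) ∈ E`. -/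
noncomputable def Pmat {n : ℕ} (E : Finset (Fin n × Fin n)) : Matrix (Fin n) (Fin n) ℝ :=
  fun i j => if (i, j) ∈ E then ((outdeg E i : ℝ))⁻¹ else 0

/-- Indicator vector of a set of nodes. -/
def ind {n : ℕ} (I : Finset (Fin n)) : Fin n → ℝ :=
  fun i => if i ∈ I then 1 else 0

/-- `v = (Id - cP)⁻¹ e_I`, the vector of mean numbers of visits to `I` before zapping. -/
noncomputable def vvec {n : ℕ} (c : ℝ) (E : Finset (Fin n × Fin n)) (I : Finset (Fin n)) : Fin n → ℝ :=
  (1 - c • Pmat E)⁻¹ *ᵥ ind I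

/-- PageRank vector `πᵀ = (1-c) zᵀ (Id - cP)⁻¹`. -/
noncomputable def pr {n : ℕ} (c : ℝ) (z : Fin n → ℝ) (E : Finset (Fin n × Fin n)) : Fin n → ℝ :=
  (1 - c) • (((1 - c • Pmat E)⁻¹)ᵀ *ᵥ z)

/-- PageRank of the set `I`: `πᵀ e_I`. -/
noncomputable def prSet {n : ℕ} (c : ℝ) (z : Fin n → ℝ) (E : Finset (Fin n × Fin n))
    (I : Finset (Fin n)) : ℝ :=
  ∑ i ∈ I, pr c z E i

/-- Node `i` has access to (some node of) the set `J`: `i ∈ J` or a directed path from `i`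
reaches `J`. -/
def access {n : ℕ} (E : Finset (Fin n × Fin n)) (i : Fin n) (J : Finset (Fin n)) : Prop :=
  ∃ j ∈ J, Relation.ReflTransGen (fun a b => (a, b) ∈ E) i j

/-- A graph is admissible for `I` (Assumption A + well-definedness): every node has at
least one outlink and every node of `I` has access to the complement of `I`. -/
def admissible {n : ℕ} (E : Finset (Fin n × Fin n)) (I : Finset (Fin n)) : Prop :=
  (∀ i, 0 < outdeg E i) ∧ ∀ i ∈ I, access E i Iᶜ

/-- Children of a node. -/
def chd {n : ℕ} (E : Finset (Fin n × Fin n)) (i : Fin n) : Finset (Fin n) :=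
  Finset.univ.filter (fun j => (i, j) ∈ E)

lemma mem_chd {n : ℕ} {E : Finset (Fin n × Fin n)} {i j : Fin n} :
    j ∈ chd E i ↔ (i, j) ∈ E := by simp [chd]

lemma outdeg_eq {n : ℕ} (E : Finset (Fin n × Fin n)) (i : Fin n) :
    outdeg E i = (chd E i).card := rfl

/-- Average over children. -/
noncomputable def avg {n : ℕ} (E : Finset (Fin n × Fin n)) (x : Fin n → ℝ) (i : Fin n) : ℝ :=
  (∑ j ∈ chd E i, x j) / ((chd E i).card : ℝ)

lemma Pmat_mulVec {n : ℕ} (E : Finset (Fin n × Fin n)) (x : Fin n → ℝ) (i : Fin n) :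
    (Pmat E *ᵥ x) i = avg E x i := by
  simp only [Matrix.mulVec, dotProduct, Pmat, avg, outdeg_eq, chd, Finset.sum_filter,
    ite_mul, zero_mul, div_eq_inv_mul, Finset.mul_sum, mul_ite, mul_zero]

lemma avg_mul {n : ℕ} {E : Finset (Fin n × Fin n)} (hE : ∀ i, 0 < outdeg E i)
    (x : Fin n → ℝ) (i : Fin n) :
    ((chd E i).card : ℝ) * avg E x i = ∑ j ∈ chd E i, x j := by
  have h : (0:ℝ) < (chd E i).card := by exact_mod_cast hE i
  unfold avg
  field_simp

lemma le_avg {n : ℕ} {E : Finset (Fin n × Fin n)} (hE : ∀ i, 0 < outdeg E i)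
    (x : Fin n → ℝ) (i : Fin n) (m : ℝ) (h : ∀ j ∈ chd E i, m ≤ x j) : m ≤ avg E x i := by
  have hp : (0:ℝ) < (chd E i).card := by exact_mod_cast hE i
  have h2 := Finset.card_nsmul_le_sum _ _ _ h
  rw [nsmul_eq_mul] at h2
  unfold avg
  rw [le_div_iff₀ hp]; linarith

lemma avg_le {n : ℕ} {E : Finset (Fin n × Fin n)} (hE : ∀ i, 0 < outdeg E i)
    (x : Fin n → ℝ) (i : Fin n) (m : ℝ) (h : ∀ j ∈ chd E i, x j ≤ m) : avg E x i ≤ m := by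
  have hp : (0:ℝ) < (chd E i).card := by exact_mod_cast hE i
  have h2 := Finset.sum_le_card_nsmul _ _ _ h
  rw [nsmul_eq_mul] at h2
  unfold avg
  rw [div_le_iff₀ hp]; linarith

lemma avg_sub {n : ℕ} (E : Finset (Fin n × Fin n)) (x y : Fin n → ℝ) (i : Fin n) :
    avg E (x - y) i = avg E x i - avg E y i := by
  simp [avg, Finset.sum_sub_distrib, sub_div]

lemma min_principle {n : ℕ} {c : ℝ} (hc0 : 0 < c) (hc1 : c < 1)
    {E : Finset (Fin n × Fin n)} (hE : ∀ i, 0 < outdeg E i)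
    (x : Fin n → ℝ) (hx : ∀ i, c * avg E x i ≤ x i) : ∀ i, 0 ≤ x i := by
  intro i
  obtain ⟨k, -, hk⟩ := Finset.exists_min_image Finset.univ x ⟨i, Finset.mem_univ i⟩
  have h1 := le_avg hE x k (x k) (fun j _ => hk j (Finset.mem_univ j))
  have h2 := hx k
  have h3 := hk i (Finset.mem_univ i)
  have h4 : c * x k ≤ c * avg E x k := by gcongr
  nlinarith

lemma isUnit_mat {n : ℕ} {c : ℝ} (hc0 : 0 < c) (hc1 : c < 1)
    {E : Finset (Fin n × Fin n)} (hE : ∀ i, 0 < outdeg E i) :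
    IsUnit (1 - c • Pmat E) := by
  rw [← Matrix.mulVec_injective_iff_isUnit]
  have key : ∀ x y : Fin n → ℝ, (1 - c • Pmat E) *ᵥ x = (1 - c • Pmat E) *ᵥ y →
      ∀ i, y i ≤ x i := by
    intro x y hxy i
    have := min_principle hc0 hc1 hE (x - y) (by
      intro i
      have h := congrFun hxy i
      simp only [Matrix.sub_mulVec, Matrix.one_mulVec, Matrix.smul_mulVec, Pi.sub_apply,
        Pi.smul_apply, Pmat_mulVec, smul_eq_mul] at h
      rw [avg_sub, Pi.sub_apply]
      linarith) i
    simpa using this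
  intro x y hxy
  funext i
  exact le_antisymm (key y x hxy.symm i) (key x y hxy i)

lemma vvec_eq {n : ℕ} {c : ℝ} (hc0 : 0 < c) (hc1 : c < 1)
    {E : Finset (Fin n × Fin n)} (hE : ∀ i, 0 < outdeg E i) (I : Finset (Fin n)) (i : Fin n) :
    vvec c E I i = ind I i + c * avg E (vvec c E I) i := by
  have hu := isUnit_mat hc0 hc1 hE
  have h : (1 - c • Pmat E) *ᵥ vvec c E I = ind I := by
    unfold vvec
    rw [Matrix.mulVec_mulVec, Matrix.mul_nonsing_inv _ ((Matrix.isUnit_iff_isUnit_det _).1 hu),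
      Matrix.one_mulVec]
  have h := congrFun h i
  simp only [Matrix.sub_mulVec, Matrix.one_mulVec, Matrix.smul_mulVec, Pi.sub_apply,
        Pi.smul_apply, Pmat_mulVec, smul_eq_mul] at h
  linarith

lemma prSet_eq {n : ℕ} (c : ℝ) (z : Fin n → ℝ) (E : Finset (Fin n × Fin n))
    (I : Finset (Fin n)) : prSet c z E I = (1 - c) * ∑ i, z i * vvec c E I i := by
  have h : prSet c z E I = ind I ⬝ᵥ pr c z E := by
    simp [prSet, dotProduct, ind]
  rw [h]
  unfold pr
  rw [dotProduct_smul, Matrix.mulVec_transpose, dotProduct_comm, ← Matrix.dotProduct_mulVec]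
  rfl

lemma improve {n : ℕ} {c : ℝ} (hc0 : 0 < c) (hc1 : c < 1)
    {E E' : Finset (Fin n × Fin n)} (hE : ∀ i, 0 < outdeg E i) (hE' : ∀ i, 0 < outdeg E' i)
    (z : Fin n → ℝ) (hz : ∀ i, 0 < z i) (I : Finset (Fin n)) (i0 : Fin n)
    (h0 : ∀ i, i ≠ i0 → chd E' i = chd E i)
    (h1 : avg E (vvec c E I) i0 < avg E' (vvec c E I) i0) :
    prSet c z E I < prSet c z E' I := by
  set v := vvec c E I with hv
  set w := vvec c E' I with hw
  have hle : ∀ i, avg E v i ≤ avg E' v i := by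
    intro i
    by_cases hi : i = i0
    · subst hi; exact h1.le
    · unfold avg; rw [h0 i hi]
  have ev := vvec_eq hc0 hc1 hE I
  have ew := vvec_eq hc0 hc1 hE' I
  rw [← hv] at ev
  rw [← hw] at ew
  have hnn := min_principle hc0 hc1 hE' (w - v) (by
    intro i
    rw [avg_sub, Pi.sub_apply, ev i, ew i]
    nlinarith [hle i])
  have hs : v i0 < w i0 := by
    have h2 := le_avg hE' (w - v) i0 0 (fun j _ => hnn j)
    rw [avg_sub] at h2
    rw [ev i0, ew i0]
    nlinarith
  rw [prSet_eq, prSet_eq]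
  apply mul_lt_mul_of_pos_left _ (by linarith)
  apply Finset.sum_lt_sum
  · intro i _
    have := hnn i
    simp only [Pi.sub_apply] at this
    exact mul_le_mul_of_nonneg_left (by linarith) (hz i).le
  · exact ⟨i0, Finset.mem_univ _, mul_lt_mul_of_pos_left hs (hz i0)⟩

set_option maxHeartbeats 4000000 in
/-- Corollary 13 (Necessity of linking to parents): with `E_in(I) ≠ ∅` and `E_Ī` fixed,
every optimal pair `(H, F)` has `F = {(i,j)}` for a single external outlink `(i,j)`
where `j` is a parent of `I`. -/
theorem stmt14 {n : ℕ} (hn : 1 ≤ n) (c : ℝ) (hc0 : 0 < c) (hc1 : c < 1)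
    (z : Fin n → ℝ) (hz : ∀ i, 0 < z i) (hz1 : ∑ i, z i = 1)
    (I : Finset (Fin n)) (hI : I.Nonempty) (hIc : (Iᶜ : Finset (Fin n)).Nonempty)
    (Ein Eext : Finset (Fin n × Fin n)) (hEinNe : Ein.Nonempty)
    (hEin : ∀ p ∈ Ein, p.1 ∉ I ∧ p.2 ∈ I)
    (hEext : ∀ p ∈ Eext, p.1 ∉ I ∧ p.2 ∉ I)
    (hout : ∀ i, i ∉ I → ∃ j, (i, j) ∈ Ein ∪ Eext)
    (H F : Finset (Fin n × Fin n))
    (hH : ∀ p ∈ H, p.1 ∈ I ∧ p.2 ∈ I) (hF : ∀ p ∈ F, p.1 ∈ I ∧ p.2 ∉ I)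
    (hAdm : admissible (H ∪ F ∪ Ein ∪ Eext) I)
    (hOpt : ∀ H' F' : Finset (Fin n × Fin n),
      (∀ p ∈ H', p.1 ∈ I ∧ p.2 ∈ I) → (∀ p ∈ F', p.1 ∈ I ∧ p.2 ∉ I) →
      admissible (H' ∪ F' ∪ Ein ∪ Eext) I →
      prSet c z (H' ∪ F' ∪ Ein ∪ Eext) I ≤ prSet c z (H ∪ F ∪ Ein ∪ Eext) I) :
    ∃ i j : Fin n, i ∈ I ∧ j ∉ I ∧ F = {(i, j)} ∧ ∃ k ∈ I, (j, k) ∈ Ein := by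
  classical
  set E := H ∪ F ∪ Ein ∪ Eext with hEdef
  have hE := hAdm.1
  set v := vvec c E I with hv
  have ev : ∀ i, v i = ind I i + c * avg E v i := vvec_eq hc0 hc1 hE I
  have hcc : 0 < 1 - c := by linarith
  have evI : ∀ i ∈ I, v i = 1 + c * avg E v i := by
    intro i hi; rw [ev i]; simp [ind, hi]
  have evO : ∀ i, i ∉ I → v i = c * avg E v i := by
    intro i hi; rw [ev i]; simp [ind, hi]
  have v0 : ∀ i, 0 ≤ v i := min_principle hc0 hc1 hE v (by
    intro i
    rw [ev i]
    have : 0 ≤ ind I i := by unfold ind; split_ifs <;> norm_num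
    linarith)
  have v1 : ∀ i ∈ I, 1 ≤ v i := by
    intro i hi
    rw [evI i hi]
    have := le_avg hE v i 0 (fun j _ => v0 j)
    have := mul_nonneg hc0.le this
    linarith
  have vtop : ∀ i, v i ≤ 1 / (1 - c) := by
    have hne : (Finset.univ : Finset (Fin n)).Nonempty := ⟨hI.choose, Finset.mem_univ _⟩
    obtain ⟨k, -, hk⟩ := Finset.exists_max_image Finset.univ v hne
    intro i
    refine (hk i (Finset.mem_univ i)).trans ?_
    rw [le_div_iff₀ hcc]
    have h1 := avg_le hE v k (v k) (fun j _ => hk j (Finset.mem_univ j))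
    have h2 := ev k
    have h3 : ind I k ≤ 1 := by unfold ind; split_ifs <;> norm_num
    have h4 : c * avg E v k ≤ c * v k := by gcongr
    linarith
  have vO : ∀ j, j ∉ I → v j < 1 / (1 - c) := by
    intro j hj
    rw [evO j hj]
    have h1 := avg_le hE v j _ (fun k _ => vtop k)
    have h4 : c * avg E v j ≤ c * (1 / (1 - c)) := by gcongr
    have h5 : 0 < 1 / (1 - c) := by positivity
    nlinarith
  obtain ⟨js, hjs, hmax⟩ := Finset.exists_max_image Iᶜ v hIc
  rw [Finset.mem_compl] at hjs
  have hmax' : ∀ j, j ∉ I → v j ≤ v js := fun j hj => hmax j (Finset.mem_compl.2 hj)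
  -- heads of maximal value are parents
  have hpos : 0 < v js := by
    obtain ⟨⟨p, k⟩, hp⟩ := hEinNe
    have hpk := hEin _ hp
    refine lt_of_lt_of_le ?_ (hmax' p hpk.1)
    rw [evO p hpk.1]
    have hm := avg_mul hE v p
    have hk : k ∈ chd E p := mem_chd.2 (by simp [hEdef, hp])
    have h1 := Finset.single_le_sum (f := v) (fun j _ => v0 j) hk
    have h2 := v1 k hpk.2
    have hcp : (0:ℝ) < (chd E p).card := by exact_mod_cast hE p
    have : 0 < avg E v p := by
      by_contra hneg
      push Not at hneg
      nlinarith
    positivity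
  have hpar : ∀ j, j ∉ I → v js ≤ v j → ∃ k ∈ I, (j, k) ∈ Ein := by
    intro j hj hvj
    by_contra hno
    push Not at hno
    have h1 := avg_le hE v j (v js) (by
      intro k hk
      apply hmax'
      intro hkI
      have hk := mem_chd.1 hk
      have h5 := hno k hkI
      simp only [hEdef, Finset.mem_union] at hk
      rcases hk with ((hk | hk) | hk) | hk
      · exact hj (hH _ hk).1
      · exact hj (hF _ hk).1
      · exact h5 hk
      · exact (hEext _ hk).2 hkI)
    have h2 := evO j hj
    have h4 : c * avg E v j ≤ c * v js := by gcongr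
    nlinarith
  -- local optimality
  have hloc : ∀ i ∈ I, ∀ C : Finset (Fin n), 
      ((∃ d ∈ C, d ∉ I) ∨ ∃ d ∈ C, d ≠ i ∧ ∃ e, e ∉ I ∧ (d, e) ∈ E) →
      ∑ j ∈ C, v j ≤ C.card * avg E v i := by
    intro i hi C hC
    by_contra hlt
    push Not at hlt
    have hCne : C.Nonempty := by
      rcases hC with ⟨d, hd, -⟩ | ⟨d, hd, -⟩ <;> exact ⟨d, hd⟩
    set H' := H.filter (fun p => p.1 ≠ i) ∪ ({i} ×ˢ (C.filter (· ∈ I))) with hH'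
    set F' := F.filter (fun p => p.1 ≠ i) ∪ ({i} ×ˢ (C.filter (· ∉ I))) with hF'
    set E' := H' ∪ F' ∪ Ein ∪ Eext with hE'def
    have m1 : ∀ b, (i, b) ∈ E' ↔ b ∈ C := by
      intro b
      have h1 : (i, b) ∉ Ein := fun h => (hEin _ h).1 hi
      have h2 : (i, b) ∉ Eext := fun h => (hEext _ h).1 hi
      simp only [hE'def, hH', hF', Finset.mem_union, Finset.mem_filter, Finset.mem_product,
        Finset.mem_singleton, h1, h2]
      tauto
    have m2 : ∀ a b, a ≠ i → ((a, b) ∈ E' ↔ (a, b) ∈ E) := by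
      intro a b hab
      simp only [hE'def, hEdef, hH', hF', Finset.mem_union, Finset.mem_filter, Finset.mem_product,
        Finset.mem_singleton, hab, ne_eq, not_false_eq_true, and_true, false_and, or_false]
    have c1 : chd E' i = C := by ext b; rw [mem_chd, m1]
    have c2 : ∀ a, a ≠ i → chd E' a = chd E a := by
      intro a ha; ext b; rw [mem_chd, mem_chd, m2 a b ha]
    have acci : ∃ j ∈ Iᶜ, Relation.ReflTransGen (fun a b => (a, b) ∈ E') i j := by
      rcases hC with ⟨d, hd, hdI⟩ | ⟨d, hd, hdi, e, he, hde⟩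
      · exact ⟨d, Finset.mem_compl.2 hdI, Relation.ReflTransGen.single ((m1 d).2 hd)⟩
      · exact ⟨e, Finset.mem_compl.2 he,
          (Relation.ReflTransGen.single ((m1 d).2 hd)).tail ((m2 d e hdi).2 hde)⟩
    have adm : admissible E' I := by
      constructor
      · intro a
        rw [outdeg_eq]
        by_cases ha : a = i
        · subst ha; rw [c1]; exact hCne.card_pos
        · rw [c2 a ha]; exact hE a
      · intro a ha
        obtain ⟨j, hj, hp⟩ := hAdm.2 a ha
        unfold access
        clear ha
        induction hp using Relation.ReflTransGen.head_induction_on with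
        | refl => exact ⟨j, hj, Relation.ReflTransGen.refl⟩
        | head hab hrest ih =>
          rename_i a b
          by_cases hai : a = i
          · subst hai; exact acci
          · obtain ⟨j', hj', hp'⟩ := ih
            exact ⟨j', hj', Relation.ReflTransGen.head ((m2 a b hai).2 hab) hp'⟩
    have hle := hOpt H' F' (by
      intro p hp
      simp only [hH', Finset.mem_union, Finset.mem_filter, Finset.mem_product,
        Finset.mem_singleton] at hp
      rcases hp with hp | hp
      · exact hH p hp.1
      · exact ⟨hp.1 ▸ hi, hp.2.2⟩) (by
      intro p hp
      simp only [hF', Finset.mem_union, Finset.mem_filter, Finset.mem_product,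
        Finset.mem_singleton] at hp
      rcases hp with hp | hp
      · exact hF p hp.1
      · exact ⟨hp.1 ▸ hi, hp.2.2⟩) adm
    refine absurd hle (not_le.2 (improve hc0 hc1 hE adm.1 z hz I i c2 ?_))
    rw [← hv]
    have hcp : (0:ℝ) < C.card := by exact_mod_cast hCne.card_pos
    have : avg E' v i = (∑ j ∈ C, v j) / C.card := by unfold avg; rw [c1]
    rw [this, lt_div_iff₀ hcp]
    linarith
  -- every node of I has larger value than every node outside
  have hbig : ∀ i ∈ I, v js < v i := by
    intro i hi
    have h1 := hloc i hi {js} (Or.inl ⟨js, by simp, hjs⟩)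
    simp only [Finset.sum_singleton, Finset.card_singleton, Nat.cast_one, one_mul] at h1
    have h2 := vO js hjs
    rw [lt_div_iff₀ hcc] at h2
    rw [evI i hi]
    have h4 : c * v js ≤ c * avg E v i := by gcongr
    linarith
  -- splitting of the children
  have hFE : ∀ i j, i ∈ I → ((i, j) ∈ F ↔ j ∈ (chd E i).filter (· ∉ I)) := by
    intro i j hi
    have h1 : (i, j) ∉ Ein := fun h => (hEin _ h).1 hi
    have h2 : (i, j) ∉ Eext := fun h => (hEext _ h).1 hi
    simp only [Finset.mem_filter, mem_chd, hEdef, Finset.mem_union, h1, h2, or_false]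
    constructor
    · intro h; exact ⟨Or.inr h, (hF _ h).2⟩
    · rintro ⟨h | h, h'⟩
      · exact absurd (hH _ h).2 h'
      · exact h
  have hstr : ∀ i j, (i, j) ∈ F → (chd E i).filter (· ∉ I) = {j} ∧ v js ≤ v j ∧
      ((chd E i).filter (· ∈ I)).Nonempty := by
    intro i j hij
    have hi := (hF _ hij).1
    have hj := (hF _ hij).2
    simp only at hi hj
    have hjT := (hFE i j hi).1 hij
    set K := (chd E i).filter (· ∈ I) with hK
    set T := (chd E i).filter (· ∉ I) with hT
    have hsum : ∑ k ∈ K, v k + ∑ k ∈ T, v k = ∑ k ∈ chd E i, v k :=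
      Finset.sum_filter_add_sum_filter_not _ _ _
    have hcard : K.card + T.card = (chd E i).card :=
      Finset.card_filter_add_card_filter_not _
    have hcardR : (K.card : ℝ) + T.card = (chd E i).card := by exact_mod_cast hcard
    have hav := avg_mul hE v i
    rw [← hsum, ← hcardR] at hav
    have hTle : ∑ k ∈ T, v k ≤ T.card * v js := by
      have := Finset.sum_le_card_nsmul T v (v js) (fun k hk => hmax' k (Finset.mem_filter.1 hk).2)
      rwa [nsmul_eq_mul] at this
    have hT1 : 1 ≤ T.card := Finset.card_pos.2 ⟨j, hjT⟩
    have hT1R : (1:ℝ) ≤ T.card := by exact_mod_cast hT1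
    have hKne : K.Nonempty := by
      by_contra hKe
      rw [Finset.not_nonempty_iff_eq_empty] at hKe
      rw [hKe] at hav
      simp only [Finset.card_empty, Nat.cast_zero, zero_add, Finset.sum_empty] at hav
      have hle : avg E v i ≤ v js := by
        by_contra hh
        push Not at hh
        nlinarith
      have hne : i ≠ js := fun h => hjs (h ▸ hi)
      have h1 := hloc i hi {i, js} (Or.inl ⟨js, by simp, hjs⟩)
      rw [Finset.sum_pair hne, Finset.card_pair hne] at h1
      have := hbig i hi
      push_cast at h1
      linarith
    have hKgt : K.card * v js < ∑ k ∈ K, v k := by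
      have := Finset.sum_lt_sum_of_nonempty (f := fun _ => v js) (g := v) hKne
        (fun k hk => hbig k (Finset.mem_filter.1 hk).2)
      simpa using this
    have hjsK : js ∉ K := fun h => hjs (Finset.mem_filter.1 h).2
    have h1 := hloc i hi (insert js K) (Or.inl ⟨js, by simp, hjs⟩)
    rw [Finset.sum_insert hjsK, Finset.card_insert_of_notMem hjsK] at h1
    push_cast at h1
    have hs0 : (0:ℝ) ≤ K.card := by positivity
    generalize (∑ k ∈ K, v k) = S at *
    have hT1' : T.card = 1 := by
      by_contra hne
      have h2 : (2:ℝ) ≤ T.card := by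
        have : 2 ≤ T.card := by omega
        exact_mod_cast this
      generalize (∑ k ∈ T, v k) = T' at *
      generalize (K.card : ℝ) = s at *
      generalize (T.card : ℝ) = t at *
      generalize avg E v i = a at *
      have e1 : (s + t) * (v js + S) ≤ (s + 1) * (S + T') := by
        rw [← hav]
        have := mul_le_mul_of_nonneg_left h1 (by linarith : 0 ≤ s + t)
        linarith
      have e2 : (s + 1) * (S + T') ≤ (s + 1) * (S + t * v js) := by gcongr
      have e3 : 0 < (t - 1) * (S - s * v js) := mul_pos (by linarith) (by linarith)
      linarith
    obtain ⟨j', hj'⟩ := Finset.card_eq_one.1 hT1'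
    have : j = j' := by rw [hj'] at hjT; simpa using hjT
    subst this
    refine ⟨hj', ?_, hKne⟩
    rw [hj'] at hav
    simp only [Finset.card_singleton, Nat.cast_one, Finset.sum_singleton] at hav
    linarith
  -- F is nonempty
  have hFne : ∃ i j, (i, j) ∈ F := by
    obtain ⟨a, ha⟩ := hI
    obtain ⟨j, hj, hp⟩ := hAdm.2 a ha
    by_contra hno
    push Not at hno
    rw [Finset.mem_compl] at hj
    apply hj
    clear hj
    induction hp with
    | refl => exact ha
    | tail hrest hbc ih =>
      rename_i b d
      by_contra hd
      exact hno b d ((hFE b d ih).2 (Finset.mem_filter.2 ⟨mem_chd.2 hbc, hd⟩))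
  obtain ⟨i, j, hij⟩ := hFne
  have hi := (hF _ hij).1
  have hj := (hF _ hij).2
  simp only at hi hj
  refine ⟨i, j, hi, hj, ?_, hpar j hj (hstr i j hij).2.1⟩
  apply Finset.eq_singleton_iff_unique_mem.2
  refine ⟨hij, ?_⟩
  rintro ⟨a, b⟩ hab
  have hai := (hF _ hab).1
  have hb := (hF _ hab).2
  simp only at hai hb
  by_cases hia : a = i
  · subst hia
    have h1 := (hFE a b hai).1 hab
    rw [(hstr a j hij).1] at h1
    simp at h1
    rw [h1]
  exfalso
  obtain ⟨hT, -, hKne⟩ := hstr a b hab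
  set K := (chd E a).filter (· ∈ I) with hK
  have hsum : ∑ k ∈ K, v k + ∑ k ∈ (chd E a).filter (· ∉ I), v k = ∑ k ∈ chd E a, v k :=
    Finset.sum_filter_add_sum_filter_not _ _ _
  have hcard : K.card + ((chd E a).filter (· ∉ I)).card = (chd E a).card :=
    Finset.card_filter_add_card_filter_not _
  rw [hT] at hsum hcard
  simp only [Finset.card_singleton, Finset.sum_singleton] at hsum hcard
  have hav := avg_mul hE v a
  rw [← hsum, ← hcard] at hav
  push_cast at hav
  have hKgt : K.card * v js < ∑ k ∈ K, v k := by
    have := Finset.sum_lt_sum_of_nonempty (f := fun _ => v js) (g := v) hKne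
      (fun k hk => hbig k (Finset.mem_filter.1 hk).2)
    simpa using this
  have h1 := hloc a hai (insert i K) (Or.inr ⟨i, by simp, fun h => hia h.symm, j, hj,
    by simp [hEdef, hij]⟩)
  have hbm := hmax' b hb
  have hs0 : (0:ℝ) ≤ K.card := by positivity
  by_cases hiK : i ∈ K
  · rw [Finset.insert_eq_of_mem hiK] at h1
    have e1 := mul_le_mul_of_nonneg_left h1 (by linarith : (0:ℝ) ≤ K.card + 1)
    have e2 : ((K.card : ℝ) + 1) * (K.card * avg E v a) = K.card * (∑ k ∈ K, v k + v b) := by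
      rw [← hav]; ring
    have e3 : (K.card : ℝ) * v b ≤ K.card * v js := by gcongr
    linarith
  · rw [Finset.sum_insert hiK, Finset.card_insert_of_notMem hiK] at h1
    push_cast at h1
    have := hbig i hi
    linarith
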